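/- arXiv:1401.5154 — 4 statements merged into one kernel-verified Lean document; each statement's English description precedes it below -/
import Mathlib

section
/- There exist absolute constants $c_1, c_2 > 0$ with the following property. For every $z \in \mathbb{C}$ and $r > 0$, set $P = z + rj \in \mathbb{H}$ and let $\Lambda(P) = \{cP + d : c, d \in \mathbb{Z}[i]\}$, a rank-4 $\mathbb{Z}$-lattice in $\mathbb{H} \cong \mathbb{R}^4$ with successive minima $m_1 \leq m_2 \leq m_3 \leq m_4$. Then $c_1 r^2 \leq m_1 m_2 m_3 m_4 \leq c_2 r^2$. -/
/-- The embedding of `ℂ` into the Hamiltonian quaternions, as span of `{1, i}`. -/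
noncomputable def toQ (z : ℂ) : Quaternion ℝ := ⟨z.re, z.im, 0, 0⟩

/-- The point `P = z + rj` of the upper half space, inside the quaternions. -/
noncomputable def Pq (z : ℂ) (r : ℝ) : Quaternion ℝ := ⟨z.re, z.im, r, 0⟩

/-- The `k`-th successive minimum of a set `S` of quaternions (w.r.t. the quaternion norm):
the least `m` such that `S` contains `k` ℝ-linearly independent vectors of norm at most `m`. -/
noncomputable def succMin (S : Set (Quaternion ℝ)) (k : ℕ) : ℝ :=
  sInf {m : ℝ | ∃ v : Fin k → Quaternion ℝ,
    (∀ i, v i ∈ S ∧ ‖v i‖ ≤ m) ∧ LinearIndependent ℝ v}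

/-- The lattice `Λ(P) = {cP + d : c, d ∈ ℤ[i]}` inside the quaternions. -/
noncomputable def latticeP (z : ℂ) (r : ℝ) : Set (Quaternion ℝ) :=
  {q | ∃ c d : GaussianInt, q = toQ (c : ℂ) * Pq z r + toQ (d : ℂ)}

/-- The real-linear identification of `ℂ²` with the quaternions, `(a, b) ↦ a + bj`. -/
noncomputable def quatOfPair (a b : ℂ) : Quaternion ℝ := ⟨a.re, a.im, b.re, b.im⟩

@[simp] lemma toQ_re (z : ℂ) : (toQ z).re = z.re := rfl

@[simp] lemma toQ_imI (z : ℂ) : (toQ z).imI = z.im := rfl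

@[simp] lemma toQ_imJ (z : ℂ) : (toQ z).imJ = 0 := rfl

@[simp] lemma toQ_imK (z : ℂ) : (toQ z).imK = 0 := rfl

@[simp] lemma Pq_re (z : ℂ) (r : ℝ) : (Pq z r).re = z.re := rfl

@[simp] lemma Pq_imI (z : ℂ) (r : ℝ) : (Pq z r).imI = z.im := rfl

@[simp] lemma Pq_imJ (z : ℂ) (r : ℝ) : (Pq z r).imJ = r := rfl

@[simp] lemma Pq_imK (z : ℂ) (r : ℝ) : (Pq z r).imK = 0 := rfl

@[simp] lemma quatOfPair_re (a b : ℂ) : (quatOfPair a b).re = a.re := rfl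

@[simp] lemma quatOfPair_imI (a b : ℂ) : (quatOfPair a b).imI = a.im := rfl

@[simp] lemma quatOfPair_imJ (a b : ℂ) : (quatOfPair a b).imJ = b.re := rfl

@[simp] lemma quatOfPair_imK (a b : ℂ) : (quatOfPair a b).imK = b.im := rfl

lemma toQ_mul_Pq_add (z : ℂ) (r : ℝ) (c d : ℂ) :
    toQ c * Pq z r + toQ d = quatOfPair (c * z + d) (c * r) := by
  ext <;> simp

lemma norm_quatOfPair_sq (a b : ℂ) :
    ‖quatOfPair a b‖ ^ 2 = Complex.normSq a + Complex.normSq b := by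
  rw [sq, ← Quaternion.normSq_eq_norm_mul_self, Quaternion.normSq_def']
  simp [Complex.normSq_apply]
  ring

/-- The squared norm of the lattice vector `cP + d`, where `P = z + rj`. -/
noncomputable def latNormSq (z : ℂ) (r : ℝ) (c d : ℂ) : ℝ :=
  Complex.normSq (c * z + d) + Complex.normSq (c * r)

lemma norm_lattice_vector_sq (z : ℂ) (r : ℝ) (c d : ℂ) :
    ‖toQ c * Pq z r + toQ d‖ ^ 2 = latNormSq z r c d := by
  rw [toQ_mul_Pq_add, norm_quatOfPair_sq, latNormSq]

/-- Lagrange's identity in `ℂ²`. -/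
lemma normSq_add_mul_normSq_add (a b e f : ℂ) :
    (Complex.normSq a + Complex.normSq b) * (Complex.normSq e + Complex.normSq f) =
      Complex.normSq (e * (starRingEnd ℂ) a + f * (starRingEnd ℂ) b) +
        Complex.normSq (a * f - b * e) := by
  simp [Complex.normSq_apply]
  ring

lemma one_le_normSq_gaussianInt {g : GaussianInt} (hg : g ≠ 0) :
    1 ≤ Complex.normSq (g : ℂ) := by
  rw [GaussianInt.intCast_real_norm g |>.symm]
  have : 0 < Zsqrtd.norm g := GaussianInt.norm_pos.2 hg
  exact_mod_cast this

lemma exists_gaussianInt_normSq_sub_le (x : ℂ) :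
    ∃ q : GaussianInt, Complex.normSq (x - q) ≤ 1 / 2 := by
  refine ⟨⟨round x.re, round x.im⟩, ?_⟩
  have h1 := abs_le.1 (abs_sub_round x.re)
  have h2 := abs_le.1 (abs_sub_round x.im)
  simp only [Complex.normSq_apply, Complex.sub_re, Complex.sub_im, GaussianInt.toComplex_def]
  simp
  nlinarith

/-- The product of the norms of two lattice vectors that are independent over `ℂ` is at
least `r`. -/
lemma sq_le_latNormSq_mul (z : ℂ) (r : ℝ) {c d c' d' : GaussianInt}
    (h : c * d' - c' * d ≠ 0) : r ^ 2 ≤ latNormSq z r c d * latNormSq z r c' d' := by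
  rw [latNormSq, latNormSq, normSq_add_mul_normSq_add]
  have h1 := one_le_normSq_gaussianInt h
  have h2 : ((c : ℂ) * z + d) * (c' * r) - c * r * (c' * z + d') =
      -(r * ((c * d' - c' * d : GaussianInt) : ℂ)) := by
    simp only [GaussianInt.toComplex_sub, GaussianInt.toComplex_mul]
    ring
  rw [h2, Complex.normSq_neg, Complex.normSq_mul, Complex.normSq_ofReal]
  nlinarith [Complex.normSq_nonneg (((c' : ℂ) * z + d') * (starRingEnd ℂ) ((c : ℂ) * z + d) +
    c' * r * (starRingEnd ℂ) ((c : ℂ) * r)), mul_self_nonneg r]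

lemma min_le_latNormSq (z : ℂ) (r : ℝ) {c d : GaussianInt} (h : c ≠ 0 ∨ d ≠ 0) :
    min (r ^ 2) 1 ≤ latNormSq z r c d := by
  rw [latNormSq]
  by_cases hc : c = 0
  · have := one_le_normSq_gaussianInt (h.resolve_left (not_not_intro hc))
    refine (min_le_right _ _).trans ?_
    simpa [hc] using this
  · have := one_le_normSq_gaussianInt hc
    refine (min_le_left _ _).trans ?_
    rw [Complex.normSq_mul, Complex.normSq_ofReal]
    nlinarith [Complex.normSq_nonneg ((c : ℂ) * z + d), mul_self_nonneg r]

/-- Size reduction of the second vector of a unimodular pair by the first one. -/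
lemma exists_reduced_second (z : ℂ) (r : ℝ) {c d c' d' : GaussianInt}
    (h : c * d' - c' * d = 1) (hpos : 0 < latNormSq z r c d) :
    ∃ c'' d'' : GaussianInt, c * d'' - c'' * d = 1 ∧
      latNormSq z r c d * latNormSq z r c'' d'' ≤ latNormSq z r c d ^ 2 / 2 + r ^ 2 := by
  set a : ℂ := c * z + d with ha
  set b : ℂ := c * r with hb
  set e : ℂ := c' * z + d' with he
  set f : ℂ := c' * r with hf
  set n : ℝ := latNormSq z r c d with hn
  have hnab : (n : ℂ) = a * (starRingEnd ℂ) a + b * (starRingEnd ℂ) b := by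
    rw [hn, latNormSq, Complex.mul_conj, Complex.mul_conj]
    push_cast
    rfl
  have hn0 : (n : ℂ) ≠ 0 := by exact_mod_cast hpos.ne'
  obtain ⟨q, hq⟩ := exists_gaussianInt_normSq_sub_le
    ((e * (starRingEnd ℂ) a + f * (starRingEnd ℂ) b) / n)
  refine ⟨c' - q * c, d' - q * d, by linear_combination h, ?_⟩
  have hc : ((c : ℂ) * d' - c' * d) = 1 := by
    simpa using congrArg GaussianInt.toComplex h
  have h1 : (((c' - q * c : GaussianInt) : ℂ) * z + ((d' - q * d : GaussianInt) : ℂ)) =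
      e - q * a := by
    rw [GaussianInt.toComplex_sub, GaussianInt.toComplex_mul, GaussianInt.toComplex_sub,
      GaussianInt.toComplex_mul, he, ha]
    ring
  have h2 : (((c' - q * c : GaussianInt) : ℂ) * r) = f - q * b := by
    rw [GaussianInt.toComplex_sub, GaussianInt.toComplex_mul, hf, hb]
    ring
  have h3 : (e - q * a) * (starRingEnd ℂ) a + (f - q * b) * (starRingEnd ℂ) b =
      n * ((e * (starRingEnd ℂ) a + f * (starRingEnd ℂ) b) / n - q) := by
    rw [mul_sub, mul_div_cancel₀ _ hn0, hnab]
    ring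
  have h4 : a * (f - q * b) - b * (e - q * a) = -(r : ℂ) := by
    rw [ha, hb, he, hf]
    linear_combination (-(r : ℂ)) * hc
  have h5 := normSq_add_mul_normSq_add a b (e - q * a) (f - q * b)
  rw [h3, h4, Complex.normSq_neg, Complex.normSq_mul (n : ℂ), Complex.normSq_ofReal,
    Complex.normSq_ofReal] at h5
  have h6 : n * latNormSq z r ((c' - q * c : GaussianInt) : ℂ) ((d' - q * d : GaussianInt) : ℂ) =
      (Complex.normSq a + Complex.normSq b) *
        (Complex.normSq (e - q * a) + Complex.normSq (f - q * b)) := by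
    rw [← h1, ← h2]
    rfl
  rw [h6, h5]
  nlinarith [mul_le_mul_of_nonneg_left hq (mul_self_nonneg n)]

/-- Every lattice `Λ(P)` has an almost reduced unimodular pair. -/
lemma exists_reduced_pair (z : ℂ) {r : ℝ} (hr : 0 < r) :
    ∃ c d c' d' : GaussianInt, c * d' - c' * d = 1 ∧
      latNormSq z r c d ≤ 4 * latNormSq z r c' d' ∧
      latNormSq z r c d * latNormSq z r c' d' ≤ 4 * r ^ 2 := by
  let S : Set ℝ := {x | ∃ c d c' d' : GaussianInt, c * d' - c' * d = 1 ∧ x = latNormSq z r c d}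
  have hlow : ∀ x ∈ S, min (r ^ 2) 1 ≤ x := by
    rintro _ ⟨c, d, c', d', h, rfl⟩
    refine min_le_latNormSq z r ?_
    by_contra! h0
    simp [h0.1, h0.2] at h
  have hne : S.Nonempty := ⟨_, 1, 0, 0, 1, by simp, rfl⟩
  have hmin : 0 < min (r ^ 2) 1 := lt_min (by positivity) one_pos
  have hμ : 0 < sInf S := hmin.trans_le (le_csInf hne hlow)
  obtain ⟨_, ⟨c, d, c', d', h, rfl⟩, hlt⟩ :=
    exists_lt_of_csInf_lt hne (show sInf S < 3 / 2 * sInf S by linarith)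
  have hS : ∀ {x}, x ∈ S → sInf S ≤ x := fun hx => csInf_le ⟨_, hlow⟩ hx
  have hpos : 0 < latNormSq z r c d := hμ.trans_le (hS ⟨c, d, c', d', h, rfl⟩)
  obtain ⟨e, f, hef, hle⟩ := exists_reduced_second z r h hpos
  have hge : sInf S ≤ latNormSq z r e f :=
    hS ⟨e, f, -c, -d, by linear_combination hef, rfl⟩
  refine ⟨c, d, e, f, hef, by linarith, ?_⟩
  nlinarith

lemma succMin_set_nonneg {S : Set (Quaternion ℝ)} {k : ℕ} (hk : 0 < k) {m : ℝ}
    (hm : m ∈ {m : ℝ | ∃ v : Fin k → Quaternion ℝ,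
      (∀ i, v i ∈ S ∧ ‖v i‖ ≤ m) ∧ LinearIndependent ℝ v}) : 0 ≤ m := by
  obtain ⟨v, hv, -⟩ := hm
  exact (norm_nonneg _).trans (hv ⟨0, hk⟩).2

lemma succMin_nonneg (S : Set (Quaternion ℝ)) {k : ℕ} (hk : 0 < k) : 0 ≤ succMin S k :=
  Real.sInf_nonneg fun _ => succMin_set_nonneg hk

lemma succMin_le {S : Set (Quaternion ℝ)} {k : ℕ} (hk : 0 < k) {m : ℝ}
    {v : Fin k → Quaternion ℝ} (hv : ∀ i, v i ∈ S ∧ ‖v i‖ ≤ m) (hi : LinearIndependent ℝ v) :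
    succMin S k ≤ m :=
  csInf_le ⟨0, fun _ => succMin_set_nonneg hk⟩ ⟨v, hv, hi⟩

/-- Successive minima are monotone as long as the set contains enough independent vectors. -/
lemma succMin_mono {S : Set (Quaternion ℝ)} {k l : ℕ} (hk : 0 < k) (hkl : k ≤ l)
    {w : Fin l → Quaternion ℝ} (hw : ∀ i, w i ∈ S) (hi : LinearIndependent ℝ w) :
    succMin S k ≤ succMin S l := by
  refine le_csInf ⟨∑ i, ‖w i‖, w, fun i => ⟨hw i, ?_⟩, hi⟩ ?_
  · exact Finset.single_le_sum (f := fun i => ‖w i‖) (fun _ _ => norm_nonneg _)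
      (Finset.mem_univ i)
  · rintro m ⟨v, hv, hvi⟩
    exact succMin_le hk (fun i => hv (Fin.castLE hkl i)) (hvi.comp _ (Fin.castLE_injective hkl))

/-- The real-linear map `t ↦ t (a + bj)` from `ℂ` to the quaternions. -/
noncomputable def complexLine (a b : ℂ) : ℂ →ₗ[ℝ] Quaternion ℝ where
  toFun t := quatOfPair (t * a) (t * b)
  map_add' s t := by ext <;> simp <;> ring
  map_smul' s t := by ext <;> simp <;> ring

/-- Vectors whose determinant with a nonzero lattice vector vanishes lie on its complex line,
so at most two of them are independent over the reals. -/
lemma exists_det_ne_zero (z : ℂ) (r : ℝ) {c d : GaussianInt} (h : c ≠ 0 ∨ d ≠ 0)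
    {e f : Fin 3 → GaussianInt}
    (hi : LinearIndependent ℝ fun i => toQ (e i : ℂ) * Pq z r + toQ (f i : ℂ)) :
    ∃ i, c * f i - e i * d ≠ 0 := by
  by_contra! h0
  have key : ∀ i, ∃ t : ℂ, complexLine ((c : ℂ) * z + d) (c * r) t =
      toQ (e i : ℂ) * Pq z r + toQ (f i : ℂ) := by
    intro i
    have hdet : (c : ℂ) * f i - e i * d = 0 := by
      simpa using congrArg GaussianInt.toComplex (h0 i)
    simp only [toQ_mul_Pq_add, complexLine, LinearMap.coe_mk, AddHom.coe_mk]
    by_cases hc : c = 0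
    · have hd : (d : ℂ) ≠ 0 := by
        simpa using h.resolve_left (not_not_intro hc)
      have he : (e i : ℂ) = 0 := by simpa [hc, hd] using hdet
      exact ⟨f i / d, by simp [hc, he, div_mul_cancel₀ _ hd]⟩
    · have hc' : (c : ℂ) ≠ 0 := by simpa using hc
      refine ⟨e i / c, ?_⟩
      congr 1
      · field_simp
        linear_combination -hdet
      · field_simp
  choose t ht using key
  have hcomp : LinearIndependent ℝ (complexLine ((c : ℂ) * z + d) (c * r) ∘ t) := by
    convert hi using 1
    exact funext ht
  have hcard := (hcomp.of_comp _).fintype_card_le_finrank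
  simp [Complex.finrank_real_complex] at hcard

lemma linearIndependent_quadruple (z : ℂ) {r : ℝ} (hr : 0 < r) {c d c' d' : GaussianInt}
    (h : c * d' - c' * d = 1) :
    LinearIndependent ℝ
      ![toQ (c : ℂ) * Pq z r + toQ (d : ℂ), toQ (Complex.I * c) * Pq z r + toQ (Complex.I * d),
        toQ (c' : ℂ) * Pq z r + toQ (d' : ℂ),
        toQ (Complex.I * c') * Pq z r + toQ (Complex.I * d')] := by
  have hdet : ((c : ℂ) * d' - c' * d) = 1 := by
    simpa using congrArg GaussianInt.toComplex h
  have hr' : (r : ℂ) ≠ 0 := by exact_mod_cast hr.ne'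
  rw [Fintype.linearIndependent_iff]
  intro g hg
  set s : ℂ := ⟨g 0, g 1⟩ with hs
  set t : ℂ := ⟨g 2, g 3⟩ with ht
  have hsum : quatOfPair (s * (c * z + d) + t * (c' * z + d')) ((s * c + t * c') * r) = 0 := by
    rw [← hg]
    simp only [Fin.sum_univ_four, toQ_mul_Pq_add]
    ext <;> simp [hs, ht] <;> ring
  have h2 : (s * c + t * c') * r = 0 := by
    apply Complex.ext
    · exact congrArg (·.imJ) hsum
    · exact congrArg (·.imK) hsum
  have h1 : s * (c * z + d) + t * (c' * z + d') = 0 := by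
    apply Complex.ext
    · exact congrArg (·.re) hsum
    · exact congrArg (·.imI) hsum
  have h3 : s * c + t * c' = 0 := (mul_eq_zero.1 h2).resolve_right hr'
  have h4 : s * d + t * d' = 0 := by linear_combination h1 - z * h3
  have hs0 : s = 0 := by linear_combination (-s) * hdet + d' * h3 - c' * h4
  have ht0 : t = 0 := by linear_combination (-t) * hdet + c * h4 - d * h3
  intro i
  fin_cases i
  · exact congrArg Complex.re hs0
  · exact congrArg Complex.im hs0
  · exact congrArg Complex.re ht0
  · exact congrArg Complex.im ht0

lemma toQ_mul_Pq_add_mem (z : ℂ) (r : ℝ) (c d : GaussianInt) :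
    toQ (c : ℂ) * Pq z r + toQ (d : ℂ) ∈ latticeP z r := ⟨c, d, rfl⟩

lemma toQ_I_mul_mem (z : ℂ) (r : ℝ) (c d : GaussianInt) :
    toQ (Complex.I * c) * Pq z r + toQ (Complex.I * d) ∈ latticeP z r := by
  have hI : ((⟨0, 1⟩ : GaussianInt) : ℂ) = Complex.I := by simp [GaussianInt.toComplex_def]
  exact ⟨⟨0, 1⟩ * c, ⟨0, 1⟩ * d, by simp only [GaussianInt.toComplex_mul, hI]⟩

lemma latNormSq_I_mul (z : ℂ) (r : ℝ) (c d : ℂ) :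
    latNormSq z r (Complex.I * c) (Complex.I * d) = latNormSq z r c d := by
  simp only [latNormSq, mul_assoc, ← mul_add, Complex.normSq_mul, Complex.normSq_I, one_mul]

lemma norm_I_mul_lattice_vector (z : ℂ) (r : ℝ) (c d : ℂ) :
    ‖toQ (Complex.I * c) * Pq z r + toQ (Complex.I * d)‖ = ‖toQ c * Pq z r + toQ d‖ := by
  rw [← sq_eq_sq₀ (norm_nonneg _) (norm_nonneg _), norm_lattice_vector_sq,
    norm_lattice_vector_sq, latNormSq_I_mul]

/-- The first and third successive minima of `Λ(P)` have product at least `r`. -/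
lemma le_succMin_one_mul_succMin_three (z : ℂ) {r : ℝ} (hr : 0 < r)
    {w : Fin 4 → Quaternion ℝ} (hw : ∀ i, w i ∈ latticeP z r) (hwi : LinearIndependent ℝ w) :
    r ≤ succMin (latticeP z r) 1 * succMin (latticeP z r) 3 := by
  have hne : ∀ k, k ≤ 4 → {m : ℝ | ∃ v : Fin k → Quaternion ℝ,
      (∀ i, v i ∈ latticeP z r ∧ ‖v i‖ ≤ m) ∧ LinearIndependent ℝ v}.Nonempty := fun k hk =>
    ⟨∑ i, ‖w i‖, fun i => w (Fin.castLE hk i), fun i => ⟨hw _,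
      Finset.single_le_sum (f := fun i => ‖w i‖) (fun _ _ => norm_nonneg _)
        (Finset.mem_univ (Fin.castLE hk i))⟩,
      hwi.comp _ (Fin.castLE_injective hk)⟩
  have key : ∀ x ∈ {m : ℝ | ∃ v : Fin 1 → Quaternion ℝ,
      (∀ i, v i ∈ latticeP z r ∧ ‖v i‖ ≤ m) ∧ LinearIndependent ℝ v},
      ∀ y ∈ {m : ℝ | ∃ v : Fin 3 → Quaternion ℝ,
      (∀ i, v i ∈ latticeP z r ∧ ‖v i‖ ≤ m) ∧ LinearIndependent ℝ v}, r ≤ x * y := by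
    rintro x ⟨v, hv, hvi⟩ y ⟨u, hu, hui⟩
    obtain ⟨⟨c, d, hcd⟩, hx⟩ := hv 0
    choose e f hef using fun i => (hu i).1
    have h0 : c ≠ 0 ∨ d ≠ 0 := by
      by_contra! h
      apply hvi.ne_zero 0
      rw [hcd, h.1, h.2, toQ_mul_Pq_add]
      ext <;> simp <;> rfl
    rw [funext hef] at hui
    obtain ⟨i, hi⟩ := exists_det_ne_zero z r h0 hui
    have h1 := sq_le_latNormSq_mul z r hi
    rw [← norm_lattice_vector_sq, ← norm_lattice_vector_sq, ← hcd, ← hef, ← mul_pow] at h1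
    have h2 : r ≤ ‖v 0‖ * ‖u i‖ := le_of_sq_le_sq h1 (by positivity)
    exact h2.trans (mul_le_mul hx (hu i).2 (norm_nonneg _) ((norm_nonneg _).trans hx))
  have hpos : ∀ x ∈ {m : ℝ | ∃ v : Fin 1 → Quaternion ℝ,
      (∀ i, v i ∈ latticeP z r ∧ ‖v i‖ ≤ m) ∧ LinearIndependent ℝ v}, 0 < x := by
    intro x hx
    obtain ⟨y, hy⟩ := hne 3 (by norm_num)
    have hle := key x hx y hy
    have hx0 := succMin_set_nonneg one_pos hx
    refine hx0.lt_of_ne ?_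
    rintro rfl
    linarith
  have h3 : ∀ x ∈ {m : ℝ | ∃ v : Fin 1 → Quaternion ℝ,
      (∀ i, v i ∈ latticeP z r ∧ ‖v i‖ ≤ m) ∧ LinearIndependent ℝ v},
      r ≤ x * succMin (latticeP z r) 3 := by
    intro x hx
    rw [← div_le_iff₀' (hpos x hx)]
    refine le_csInf (hne 3 (by norm_num)) fun y hy => ?_
    rw [div_le_iff₀' (hpos x hx)]
    exact key x hx y hy
  have hm3 : 0 < succMin (latticeP z r) 3 := by
    obtain ⟨x, hx⟩ := hne 1 (by norm_num)
    exact pos_of_mul_pos_right (hr.trans_le (h3 x hx)) (hpos x hx).le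
  rw [← div_le_iff₀ hm3]
  refine le_csInf (hne 1 (by norm_num)) fun x hx => ?_
  rw [div_le_iff₀ hm3]
  exact h3 x hx

/-- There are absolute constants `c₁, c₂ > 0` such that for every `z ∈ ℂ` and
`r > 0`, the successive minima `m₁ ≤ m₂ ≤ m₃ ≤ m₄` of the lattice `Λ(P)` with `P = z + rj`
satisfy `c₁ r² ≤ m₁m₂m₃m₄ ≤ c₂ r²`. -/
theorem statement1 :
    ∃ c₁ c₂ : ℝ, 0 < c₁ ∧ 0 < c₂ ∧
      ∀ (z : ℂ) (r : ℝ), 0 < r →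
        c₁ * r ^ 2 ≤ succMin (latticeP z r) 1 * succMin (latticeP z r) 2 *
            succMin (latticeP z r) 3 * succMin (latticeP z r) 4 ∧
        succMin (latticeP z r) 1 * succMin (latticeP z r) 2 *
            succMin (latticeP z r) 3 * succMin (latticeP z r) 4 ≤ c₂ * r ^ 2 := by
  refine ⟨1, 16, one_pos, by norm_num, fun z r hr => ?_⟩
  obtain ⟨c, d, c', d', hdet, hle, hprod⟩ := exists_reduced_pair z hr
  have hli := linearIndependent_quadruple z hr hdet
  set w := ![toQ (c : ℂ) * Pq z r + toQ (d : ℂ),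
    toQ (Complex.I * c) * Pq z r + toQ (Complex.I * d),
    toQ (c' : ℂ) * Pq z r + toQ (d' : ℂ),
    toQ (Complex.I * c') * Pq z r + toQ (Complex.I * d')]
  have hmem : ∀ i, w i ∈ latticeP z r := by
    intro i
    fin_cases i
    · exact toQ_mul_Pq_add_mem z r c d
    · exact toQ_I_mul_mem z r c d
    · exact toQ_mul_Pq_add_mem z r c' d'
    · exact toQ_I_mul_mem z r c' d'
  have hmono : ∀ k l, 0 < k → k ≤ l → l ≤ 4 →
      succMin (latticeP z r) k ≤ succMin (latticeP z r) l := fun k l hk hkl hl =>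
    succMin_mono hk hkl (fun i => hmem (Fin.castLE hl i)) (hli.comp _ (Fin.castLE_injective hl))
  have h12 := hmono 1 2 (by norm_num) (by norm_num) (by norm_num)
  have h34 := hmono 3 4 (by norm_num) (by norm_num) (by norm_num)
  have h1 := succMin_nonneg (latticeP z r) (k := 1) (by norm_num)
  have h3 := succMin_nonneg (latticeP z r) (k := 3) (by norm_num)
  have h13 := le_succMin_one_mul_succMin_three z hr hmem hli
  rw [← norm_lattice_vector_sq, ← norm_lattice_vector_sq] at hle hprod
  set x := ‖toQ (c : ℂ) * Pq z r + toQ (d : ℂ)‖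
  set y := ‖toQ (c' : ℂ) * Pq z r + toQ (d' : ℂ)‖
  have hx0 : 0 ≤ x := norm_nonneg _
  have hy0 : 0 ≤ y := norm_nonneg _
  have hxy : x ≤ 2 * y := le_of_sq_le_sq (by linarith [mul_pow 2 y 2]) (by positivity)
  have hm2 : succMin (latticeP z r) 2 ≤ x := by
    refine succMin_le (by norm_num) (v := w ∘ Fin.castLE (show 2 ≤ 4 by norm_num))
      (fun i => ⟨hmem _, ?_⟩) (hli.comp _ (Fin.castLE_injective (by norm_num)))
    fin_cases i
    · exact le_rfl
    · exact (norm_I_mul_lattice_vector z r c d).le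
  have hm4 : succMin (latticeP z r) 4 ≤ 2 * y := by
    refine succMin_le (by norm_num) (v := w) (fun i => ⟨hmem _, ?_⟩) hli
    fin_cases i
    · exact hxy
    · exact (norm_I_mul_lattice_vector z r c d).le.trans hxy
    · change y ≤ 2 * y
      linarith
    · exact (norm_I_mul_lattice_vector z r c' d').le.trans (by linarith)
  set a₁ := succMin (latticeP z r) 1
  set a₂ := succMin (latticeP z r) 2
  set a₃ := succMin (latticeP z r) 3
  set a₄ := succMin (latticeP z r) 4
  have h2 : 0 ≤ a₂ := h1.trans h12
  have h4 : 0 ≤ a₄ := h3.trans h34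
  constructor
  · calc 1 * r ^ 2 = r * r := by ring
      _ ≤ (a₁ * a₃) * (a₁ * a₃) := by gcongr
      _ ≤ (a₁ * a₃) * (a₂ * a₄) := by gcongr
      _ = a₁ * a₂ * a₃ * a₄ := by ring
  · calc a₁ * a₂ * a₃ * a₄ ≤ x * x * (2 * y) * (2 * y) := by
          gcongr
          · exact h12.trans hm2
          · exact h34.trans hm4
      _ = 4 * (x ^ 2 * y ^ 2) := by ring
      _ ≤ 16 * r ^ 2 := by linarith
end

section
/- Let $A > 0$ and $T \geq 1$ be real. For real $s$ with $|s| < A$, define $h(is) = \frac{\cos\!\left(\frac{\pi s}{2A}\right)\cosh\!\left(\frac{\pi T}{2A}\right)}{\cos\!\left(\frac{\pi s}{A}\right) + \cosh\!\left(\frac{\pi T}{A}\right)}.$ Then $h(is) > 0$ for all such $s$, and moreover $h(is) > 1/8$ whenever in addition $|s| < A/2$ and $T - A/2 < |s| < T + A/2$. -/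
open Real

theorem cosh_pi_div_two_lt : Real.cosh (π / 2) < 2.7 := by
  have hmono : Real.cosh (π / 2) < Real.cosh 1.6 := by
    rw [Real.cosh_lt_cosh, abs_of_pos (by positivity), abs_of_pos (by norm_num)]
    linarith [Real.pi_lt_d2]
  have hpow : Real.exp 1.6 ^ 5 = Real.exp 1 ^ 8 := by
    rw [← Real.exp_nat_mul, ← Real.exp_nat_mul]
    norm_num
  have hupper : Real.exp 1.6 < 4.96 := by
    refine lt_of_pow_lt_pow_left₀ 5 (by norm_num) ?_
    rw [hpow]
    calc Real.exp 1 ^ 8 < 2.7182818286 ^ 8 :=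
          pow_lt_pow_left₀ Real.exp_one_lt_d9 (Real.exp_pos 1).le (by norm_num)
      _ < 4.96 ^ 5 := by norm_num
  have hlower : (2.6 : ℝ) ≤ Real.exp 1.6 := by
    linarith [Real.add_one_le_exp (1.6 : ℝ)]
  have hinv : Real.exp (-1.6) ≤ 2.6⁻¹ := by
    rw [Real.exp_neg]
    exact inv_anti₀ (by norm_num) hlower
  rw [Real.cosh_eq 1.6] at hmono
  norm_num at hinv hmono hupper ⊢
  linarith

theorem cos_two_mul_add_cosh_two_mul (a b : ℝ) :
    Real.cos (2 * a) + Real.cosh (2 * b) = 2 * (Real.cos a ^ 2 + Real.cosh b ^ 2 - 1) := by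
  rw [Real.cos_two_mul, Real.cosh_two_mul, Real.sinh_sq]
  ring

theorem cos_mul_cosh_div_pos {a b : ℝ} (ha : |a| < π / 2) :
    0 < Real.cos a * Real.cosh b / (Real.cos (2 * a) + Real.cosh (2 * b)) := by
  have hc : 0 < Real.cos a := Real.cos_pos_of_mem_Ioo (abs_lt.mp ha)
  have hC := Real.one_le_cosh b
  rw [cos_two_mul_add_cosh_two_mul]
  have hden : 0 < Real.cos a ^ 2 + Real.cosh b ^ 2 - 1 := by nlinarith
  positivity

theorem one_eighth_lt_cos_mul_cosh_div {a b : ℝ} (ha : |a| ≤ π / 4) (hb : |b| ≤ π / 2) :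
    1 / 8 < Real.cos a * Real.cosh b / (Real.cos (2 * a) + Real.cosh (2 * b)) := by
  have hc : 0.7 < Real.cos a := by
    have h := Real.cos_le_cos_of_nonneg_of_le_pi (abs_nonneg a) (by linarith [Real.pi_pos]) ha
    rw [Real.cos_abs, Real.cos_pi_div_four] at h
    have hsqrt : (1.4 : ℝ) < √2 := Real.lt_sqrt_of_sq_lt (by norm_num)
    norm_num at hsqrt ⊢
    linarith
  have hc1 := Real.cos_le_one a
  have hC := Real.one_le_cosh b
  have hC' : Real.cosh b < 2.7 := by
    refine lt_of_le_of_lt ?_ cosh_pi_div_two_lt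
    rwa [Real.cosh_le_cosh, abs_of_pos (by positivity : 0 < π / 2)]
  rw [cos_two_mul_add_cosh_two_mul, lt_div_iff₀ (by nlinarith)]
  generalize Real.cos a = c at *
  generalize Real.cosh b = C at *
  norm_num at hc hC'
  have h₁ : 0 ≤ (c - 7 / 10) * (1 - c) := mul_nonneg (by linarith) (by linarith)
  have h₂ : 0 ≤ (c - 7 / 10) * (4 * C - 1.7) := mul_nonneg (by linarith) (by linarith)
  have h₃ : 0 ≤ C * (2.7 - C) := mul_nonneg (by linarith) (by linarith)
  linarith

/-- For `A > 0` and `T ≥ 1`, the value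
`h(is) = cos(πs/(2A)) cosh(πT/(2A)) / (cos(πs/A) + cosh(πT/A))` is positive for every real
`s` with `|s| < A`, and `h(is) > 1/8` whenever in addition `|s| < A/2` and
`T - A/2 < |s| < T + A/2`. -/
theorem statement9 (A T : ℝ) (hA : 0 < A) (hT : 1 ≤ T) :
    (∀ s : ℝ, |s| < A →
      0 < Real.cos (π * s / (2 * A)) * Real.cosh (π * T / (2 * A)) /
        (Real.cos (π * s / A) + Real.cosh (π * T / A))) ∧
    (∀ s : ℝ, |s| < A → |s| < A / 2 → T - A / 2 < |s| → |s| < T + A / 2 →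
      1 / 8 < Real.cos (π * s / (2 * A)) * Real.cosh (π * T / (2 * A)) /
        (Real.cos (π * s / A) + Real.cosh (π * T / A))) := by
  have hmul (x : ℝ) : π * x / A = 2 * (π * x / (2 * A)) := by
    field_simp
  have habs {x r : ℝ} (hx : |x| < r * A) : |π * x / (2 * A)| < r * (π / 2) := by
    rw [abs_div, abs_mul, abs_of_pos Real.pi_pos, abs_of_pos (by positivity : 0 < 2 * A),
      div_lt_iff₀ (by positivity)]
    nlinarith [Real.pi_pos]
  refine ⟨fun s hs => ?_, fun s _ hs hTs _ => ?_⟩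
  · rw [hmul s, hmul T]
    have h := habs (x := s) (r := 1) (by linarith)
    exact cos_mul_cosh_div_pos (by linarith)
  · rw [hmul s, hmul T]
    have ha := habs (x := s) (r := 1 / 2) (by linarith)
    have hb := habs (x := T) (r := 1) (by rw [abs_of_pos (by linarith)]; linarith)
    exact one_eighth_lt_cos_mul_cosh_div (by linarith) (by linarith)
end

section
/- For every real $A > 2$ there exists a constant $C_A > 0$ such that for all real $T \geq 1$ and all $u > 0$ the following holds: with $v = \log\!\left(1 + u + \sqrt{u^2 + 2u}\right)$, $\left| \frac{A T \sin(Tv) + A^2 \cos(Tv) \tanh(Av)}{(2\pi)^2 \sqrt{u^2 + 2u}\, \cosh(Av)} \right| \;\leq\; C_A \min\!\left(T^2,\ \frac{T}{\sqrt{u}\,(1+u)^A}\right).$ -/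
open Real

lemma Real.tanh_le_two_mul {x : ℝ} (hx : 0 ≤ x) : Real.tanh x ≤ 2 * x := by
  rw [Real.tanh_eq_sinh_div_cosh, div_le_iff₀ (Real.cosh_pos x), Real.sinh_eq, Real.cosh_eq]
  have h : Real.exp (-x) = Real.exp (-(2 * x)) * Real.exp x := by
    rw [← Real.exp_add]; ring_nf
  have h1 : 1 - 2 * x ≤ Real.exp (-(2 * x)) := Real.one_sub_le_exp_neg _
  have h2 := mul_le_mul_of_nonneg_right h1 (Real.exp_pos x).le
  have h3 := mul_nonneg hx (Real.exp_pos (-x)).le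
  rw [← h] at h2
  linarith

lemma abs_sin_add_cos_tanh_le {A T v : ℝ} (hA : 0 ≤ A) (hT : 1 ≤ T) :
    |A * T * Real.sin (T * v) + A ^ 2 * Real.cos (T * v) * Real.tanh (A * v)| ≤
      (A + A ^ 2) * T := by
  have hs := Real.abs_sin_le_one (T * v)
  have hc := Real.abs_cos_le_one (T * v)
  have ht := (Real.abs_tanh_lt_one (A * v)).le
  refine (abs_add_le _ _).trans ?_
  simp only [abs_mul, abs_pow, abs_of_nonneg hA, abs_of_nonneg (zero_le_one.trans hT)]
  calc A * T * |Real.sin (T * v)| + A ^ 2 * |Real.cos (T * v)| * |Real.tanh (A * v)|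
      ≤ A * T * 1 + A ^ 2 * 1 * 1 := by gcongr
    _ ≤ (A + A ^ 2) * T := by nlinarith [sq_nonneg A]

lemma abs_sin_add_cos_tanh_le_mul {A T v : ℝ} (hA : 0 ≤ A) (hT : 1 ≤ T) (hv : 0 ≤ v) :
    |A * T * Real.sin (T * v) + A ^ 2 * Real.cos (T * v) * Real.tanh (A * v)| ≤
      (A + 2 * A ^ 3) * T ^ 2 * v := by
  have hT0 : 0 ≤ T := zero_le_one.trans hT
  have hs : |Real.sin (T * v)| ≤ T * v :=
    Real.abs_sin_le_abs.trans_eq (abs_of_nonneg (by positivity))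
  have hc := Real.abs_cos_le_one (T * v)
  have ht : |Real.tanh (A * v)| ≤ 2 * (A * v) := by
    have h0 : 0 ≤ Real.tanh (A * v) := by
      rw [Real.tanh_eq_sinh_div_cosh]
      exact div_nonneg (Real.sinh_nonneg_iff.2 (by positivity)) (Real.cosh_pos _).le
    rw [abs_of_nonneg h0]
    exact Real.tanh_le_two_mul (by positivity)
  refine (abs_add_le _ _).trans ?_
  simp only [abs_mul, abs_pow, abs_of_nonneg hA, abs_of_nonneg hT0]
  calc A * T * |Real.sin (T * v)| + A ^ 2 * |Real.cos (T * v)| * |Real.tanh (A * v)|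
      ≤ A * T * (T * v) + A ^ 2 * 1 * (2 * (A * v)) := by gcongr
    _ = A * T ^ 2 * v + 2 * A ^ 3 * v * 1 := by ring
    _ ≤ A * T ^ 2 * v + 2 * A ^ 3 * v * T ^ 2 := by gcongr; exact one_le_pow₀ hT
    _ = (A + 2 * A ^ 3) * T ^ 2 * v := by ring

/-- For every `A > 2` there is `C_A > 0` such that for all `T ≥ 1` and
all `u > 0`, with `v = log(1 + u + √(u² + 2u))`,
`|(AT sin(Tv) + A² cos(Tv) tanh(Av)) / ((2π)² √(u²+2u) cosh(Av))|
  ≤ C_A · min(T², T/(√u (1+u)^A))`. -/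
theorem statement10 (A : ℝ) (hA : 2 < A) :
    ∃ C : ℝ, 0 < C ∧
      ∀ T : ℝ, 1 ≤ T → ∀ u : ℝ, 0 < u →
        ∀ v : ℝ, v = Real.log (1 + u + Real.sqrt (u ^ 2 + 2 * u)) →
          |(A * T * Real.sin (T * v) + A ^ 2 * Real.cos (T * v) * Real.tanh (A * v)) /
              ((2 * π) ^ 2 * Real.sqrt (u ^ 2 + 2 * u) * Real.cosh (A * v))| ≤
            C * min (T ^ 2) (T / (Real.sqrt u * (1 + u) ^ A)) := by
  have hA0 : 0 < A := by linarith
  refine ⟨2 * (A + A ^ 2 + A ^ 3), by positivity, ?_⟩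
  intro T hT u hu v hv
  have hT0 : 0 < T := by linarith
  set s := Real.sqrt (u ^ 2 + 2 * u) with hs
  have hs0 : 0 < s := Real.sqrt_pos.2 (by positivity)
  have hss : s ^ 2 = u ^ 2 + 2 * u := Real.sq_sqrt (by positivity)
  have hv0 : 0 ≤ v := by rw [hv]; exact Real.log_nonneg (by linarith)
  have hvs : v ≤ s := by
    have h : Real.arsinh s = v := by
      rw [Real.arsinh, hv, hss, show 1 + (u ^ 2 + 2 * u) = (1 + u) ^ 2 by ring,
        Real.sqrt_sq (by positivity), add_comm]
    rw [← Real.sinh_arsinh s, h]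
    exact Real.self_le_sinh_iff.2 hv0
  have hpi : 1 ≤ (2 * π) ^ 2 := one_le_pow₀ (by linarith [Real.pi_gt_three])
  have hcosh := Real.cosh_pos (A * v)
  have hD : 0 < (2 * π) ^ 2 * s * Real.cosh (A * v) := by positivity
  rw [abs_div, abs_of_pos hD, div_le_iff₀ hD, min_def]
  split_ifs
  · have hden : v ≤ (2 * π) ^ 2 * s * Real.cosh (A * v) := by
      calc v ≤ 1 * s * 1 := by linarith
        _ ≤ _ := by gcongr; exact Real.one_le_cosh _
    calc _ ≤ (A + 2 * A ^ 3) * T ^ 2 * v := abs_sin_add_cos_tanh_le_mul hA0.le hT hv0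
      _ ≤ (2 * (A + A ^ 2 + A ^ 3)) * T ^ 2 * ((2 * π) ^ 2 * s * Real.cosh (A * v)) := by
        gcongr
        nlinarith [sq_nonneg A]
  · have hcosh_ge : (1 + u) ^ A / 2 ≤ Real.cosh (A * v) := by
      have h : (1 + u) ^ A ≤ Real.exp (A * v) := by
        rw [Real.rpow_def_of_pos (by positivity), mul_comm, hv]
        have hlog : Real.log (1 + u) ≤ Real.log (1 + u + s) :=
          Real.log_le_log (by positivity) (by linarith)
        gcongr
      rw [Real.cosh_eq]
      linarith [Real.exp_pos (-(A * v))]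
    have hsu : Real.sqrt u ≤ s := Real.sqrt_le_sqrt (by nlinarith)
    have hden : Real.sqrt u * (1 + u) ^ A / 2 ≤ (2 * π) ^ 2 * s * Real.cosh (A * v) := by
      calc _ = 1 * Real.sqrt u * ((1 + u) ^ A / 2) := by ring
        _ ≤ _ := by gcongr
    have hE : 0 < Real.sqrt u * (1 + u) ^ A := by positivity
    calc _ ≤ (A + A ^ 2) * T := abs_sin_add_cos_tanh_le hA0.le hT
      _ ≤ (A + A ^ 2 + A ^ 3) * T := by
        refine mul_le_mul_of_nonneg_right ?_ hT0.le
        linarith [pow_pos hA0 3]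
      _ = 2 * (A + A ^ 2 + A ^ 3) * (T / (Real.sqrt u * (1 + u) ^ A)) *
          (Real.sqrt u * (1 + u) ^ A / 2) := by field_simp
      _ ≤ _ := by gcongr
end

section
/- Let $a, b, c, d \in \mathbb{C}$ with $ad - bc = 1$, let $z \in \mathbb{C}$ and $r > 0$, and set $P = z + rj \in \mathbb{H}$ and $Q = (aP + b)(cP + d)^{-1}$ (quaternion arithmetic). Then $\frac{\|Q - P\|^2}{2\,\mathrm{Im}(Q)\,\mathrm{Im}(P)} \;\geq\; \frac{1}{2}\left(\frac{1}{\|cP + d\|} - \|cP + d\|\right)^2,$ where $\mathrm{Im}$ denotes the $j$-coordinate of a quaternion and $\|\cdot\|$ the quaternion norm. -/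
theorem imJ_mul_star_of_det_eq_one (a b c d z : ℂ) (r : ℝ) (h : a * d - b * c = 1) :
    ((toQ a * Pq z r + toQ b) * star (toQ c * Pq z r + toQ d)).imJ = r := by
  have hre := congrArg Complex.re h
  simp only [Complex.sub_re, Complex.mul_re, Complex.one_re] at hre
  simp only [Quaternion.imJ_mul, Quaternion.re_add, Quaternion.imI_add,
    Quaternion.imJ_add, Quaternion.imK_add, Quaternion.re_mul, Quaternion.imI_mul,
    Quaternion.imK_mul, Quaternion.re_star, Quaternion.imI_star, Quaternion.imJ_star,
    Quaternion.imK_star]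
  simp only [toQ, Pq]
  linear_combination r * hre

theorem Quaternion.sq_imJ_le_sq_norm (q : Quaternion ℝ) : q.imJ ^ 2 ≤ ‖q‖ ^ 2 := by
  rw [sq ‖q‖, ← Quaternion.normSq_eq_norm_mul_self, Quaternion.normSq_def']
  nlinarith [sq_nonneg q.re, sq_nonneg q.imI, sq_nonneg q.imK]

/-- For `a, b, c, d ∈ ℂ` with `ad - bc = 1`, `z ∈ ℂ`, `r > 0`,
`P = z + rj` and `Q = (aP + b)(cP + d)⁻¹` (quaternion arithmetic):
`‖Q - P‖² / (2 Im(Q) Im(P)) ≥ (1/2) (1/‖cP + d‖ - ‖cP + d‖)²`,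
where `Im` is the `j`-coordinate of a quaternion and `‖·‖` the quaternion norm. -/
theorem statement14 (a b c d z : ℂ) (r : ℝ) (h : a * d - b * c = 1) (hr : 0 < r) :
    ‖(toQ a * Pq z r + toQ b) * (toQ c * Pq z r + toQ d)⁻¹ - Pq z r‖ ^ 2 /
        (2 * ((toQ a * Pq z r + toQ b) * (toQ c * Pq z r + toQ d)⁻¹).imJ * (Pq z r).imJ) ≥
      (1 / 2) * (1 / ‖toQ c * Pq z r + toQ d‖ - ‖toQ c * Pq z r + toQ d‖) ^ 2 := by
  have hJ := imJ_mul_star_of_det_eq_one a b c d z r h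
  set v := toQ a * Pq z r + toQ b
  set w := toQ c * Pq z r + toQ d
  have hw : w ≠ 0 := by
    intro hw
    simp only [hw, star_zero, mul_zero, Quaternion.imJ_zero] at hJ
    exact hr.ne hJ
  have hN : 0 < ‖w‖ := norm_pos_iff.mpr hw
  have hQ : (v * w⁻¹).imJ = r / ‖w‖ ^ 2 := by
    rw [Quaternion.inv_def, Algebra.mul_smul_comm, Quaternion.imJ_smul, hJ,
      Quaternion.normSq_eq_norm_mul_self, smul_eq_mul, div_eq_inv_mul, sq]
  have hle := Quaternion.sq_imJ_le_sq_norm (v * w⁻¹ - Pq z r)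
  have hP : (Pq z r).imJ = r := rfl
  rw [Quaternion.imJ_sub, hQ, hP] at hle
  rw [hQ, hP, ge_iff_le]
  calc (1 / 2) * (1 / ‖w‖ - ‖w‖) ^ 2
      = (r / ‖w‖ ^ 2 - r) ^ 2 / (2 * (r / ‖w‖ ^ 2) * r) := by
        field_simp
    _ ≤ _ := by gcongr
end
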